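/- Let n, k, k' ∈ ℕ₀. Then ∫_{−1}^{1} 𝖯_{k+n}^{n}(x) 𝖯_{k'+n}^{−n}(x) dx = ((−1)^n / (n+k+1/2)) δ_{k,k'}, where δ_{k,k'} is the Kronecker delta. -/

import Mathlib

/-- Pochhammer symbol `(a)_k = a (a+1) ⋯ (a+k-1)` for complex `a`. -/
noncomputable def cpoch (a : ℂ) (k : ℕ) : ℂ := ∏ i ∈ Finset.range k, (a + i)

/-- Gauss hypergeometric series `₂F₁(a, b; c; z)`. -/
noncomputable def hyp2F1 (a b c z : ℂ) : ℂ :=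
  ∑' k : ℕ, cpoch a k * cpoch b k / (cpoch c k * (Nat.factorial k : ℂ)) * z ^ k

/-- Ferrers function of the first kind `𝖯_ν^{−μ}(x)`. -/
noncomputable def ferrersP (ν μ : ℂ) (x : ℝ) : ℂ :=
  (1 / Complex.Gamma (μ + 1)) * (((1 - x) / (1 + x) : ℝ) : ℂ) ^ (μ / 2) *
    hyp2F1 (-ν) (ν + 1) (μ + 1) (((1 - x) / 2 : ℝ) : ℂ)

/-- Ferrers function of the first kind with positive integer order `𝖯_ν^{m}(x)`. -/
noncomputable def ferrersPosP (ν : ℂ) (m : ℕ) (x : ℝ) : ℂ :=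
  (-1) ^ m * (Complex.Gamma (ν + m + 1) / Complex.Gamma (ν - m + 1)) * ferrersP ν (m : ℂ) x

section PolynomialIntegration

open Polynomial

theorem Polynomial.integral_eval_mul_eval_derivative (P Q : ℝ[X]) (h0 : Q.eval 0 = 0)
    (h1 : Q.eval 1 = 0) :
    ∫ t in (0 : ℝ)..1, P.eval t * (derivative Q).eval t =
      -∫ t in (0 : ℝ)..1, (derivative P).eval t * Q.eval t := by
  rw [intervalIntegral.integral_mul_deriv_eq_deriv_mul (fun t _ => P.hasDerivAt t)
    (fun t _ => Q.hasDerivAt t) ((derivative P).continuous.intervalIntegrable _ _)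
    ((derivative Q).continuous.intervalIntegrable _ _), h0, h1]
  simp

theorem Polynomial.eval_iterate_derivative_X_pow_mul_one_sub_X_pow {m j : ℕ} (hj : j < m) {t : ℝ}
    (ht : t = 0 ∨ t = 1) : (derivative^[j] (X ^ m * (1 - X) ^ m : ℝ[X])).eval t = 0 := by
  have hdvd : (X * (1 - X) : ℝ[X]) ^ (m - j) ∣ derivative^[j] (X ^ m * (1 - X) ^ m) :=
    pow_sub_dvd_iterate_derivative_of_pow_dvd j (by rw [mul_pow])
  refine eval_eq_zero_of_dvd_of_eval_eq_zero hdvd ?_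
  have : m - j ≠ 0 := by omega
  rcases ht with rfl | rfl <;> simp [this]

theorem Polynomial.integral_eval_mul_eval_iterate_derivative (P : ℝ[X]) {m j : ℕ} (hj : j ≤ m) :
    ∫ t in (0 : ℝ)..1, P.eval t * (derivative^[j] (X ^ m * (1 - X) ^ m : ℝ[X])).eval t =
      (-1) ^ j * ∫ t in (0 : ℝ)..1,
        (derivative^[j] P).eval t * (X ^ m * (1 - X) ^ m : ℝ[X]).eval t := by
  induction j generalizing P with
  | zero => simp
  | succ j ih =>
    rw [Function.iterate_succ_apply', integral_eval_mul_eval_derivative _ _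
      (eval_iterate_derivative_X_pow_mul_one_sub_X_pow (by omega) (.inl rfl))
      (eval_iterate_derivative_X_pow_mul_one_sub_X_pow (by omega) (.inr rfl)),
      ih _ (by omega), Function.iterate_succ_apply]
    ring

theorem Polynomial.integral_eval_X_pow_mul_one_sub_X_pow (m : ℕ) :
    ∫ t in (0 : ℝ)..1, (X ^ m * (1 - X) ^ m : ℝ[X]).eval t =
      (m.factorial : ℝ) ^ 2 / ((2 * m + 1).factorial : ℝ) := by
  have hre : 0 < ((m : ℂ) + 1).re := by
    simp only [Complex.add_re, Complex.natCast_re, Complex.one_re]; positivity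
  have h := Complex.Gamma_mul_Gamma_eq_betaIntegral hre hre
  have hG : Complex.Gamma ((m : ℂ) + 1 + (m + 1)) = ((2 * m + 1).factorial : ℂ) := by
    rw [← Complex.Gamma_nat_eq_factorial]; push_cast; ring_nf
  have hB : Complex.betaIntegral ((m : ℂ) + 1) (m + 1) =
      ((∫ t in (0 : ℝ)..1, (X ^ m * (1 - X) ^ m : ℝ[X]).eval t : ℝ) : ℂ) := by
    rw [Complex.betaIntegral, ← intervalIntegral.integral_ofReal]
    refine intervalIntegral.integral_congr fun t _ => ?_
    simp [Complex.cpow_natCast]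
  rw [hG, hB, Complex.Gamma_nat_eq_factorial] at h
  have h' : (m.factorial : ℝ) * m.factorial = (2 * m + 1).factorial *
      ∫ t in (0 : ℝ)..1, (X ^ m * (1 - X) ^ m : ℝ[X]).eval t := by exact_mod_cast h
  rw [eq_div_iff (by positivity), sq, h', mul_comm]

/-- The Rodrigues form of a Jacobi polynomial: the `k`-th derivative of `(X (1 - X)) ^ (k + n)` is
`(X (1 - X)) ^ n` times a polynomial of degree at most `k` with known top coefficient. -/
theorem Polynomial.exists_iterate_derivative_eq_mul (n k : ℕ) :
    ∃ Q : ℝ[X], derivative^[k] (X ^ (k + n) * (1 - X) ^ (k + n) : ℝ[X]) =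
        X ^ n * (1 - X) ^ n * Q ∧ Q.natDegree ≤ k ∧
      Q.coeff k = (-1) ^ k * ((2 * k + 2 * n).factorial / (k + 2 * n).factorial : ℝ) := by
  have hdvd : (X * (1 - X) : ℝ[X]) ^ (k + n - k) ∣
      derivative^[k] (X ^ (k + n) * (1 - X) ^ (k + n)) :=
    pow_sub_dvd_iterate_derivative_of_pow_dvd k (by rw [mul_pow])
  rw [Nat.add_sub_cancel_left] at hdvd
  obtain ⟨Q, hQ⟩ := hdvd
  have hdeg1 : (X * (1 - X) : ℝ[X]).natDegree = 2 := by compute_degree!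
  have hcoeff1 : (X * (1 - X) : ℝ[X]).coeff 2 = -1 := by
    simp [mul_sub, ← sq, coeff_X]
  have hcoeff (m : ℕ) : ((X * (1 - X) : ℝ[X]) ^ m).coeff (m * 2) = (-1) ^ m := by
    rw [coeff_pow_of_natDegree_le hdeg1.le, hcoeff1]
  have hdeg (m : ℕ) : ((X * (1 - X) : ℝ[X]) ^ m).natDegree = m * 2 := by
    rw [natDegree_pow, hdeg1]
  have hne : (X * (1 - X) : ℝ[X]) ^ n ≠ 0 := by
    refine pow_ne_zero _ fun h => ?_
    simp [h] at hdeg1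
  have hQdeg : Q.natDegree ≤ k := by
    by_cases hQ0 : Q = 0
    · simp [hQ0]
    · have h := natDegree_iterate_derivative (X ^ (k + n) * (1 - X) ^ (k + n) : ℝ[X]) k
      rw [hQ, natDegree_mul hne hQ0, hdeg, ← mul_pow, hdeg] at h
      omega
  refine ⟨Q, by rw [hQ, mul_pow], hQdeg, ?_⟩
  have h := congrArg (fun p => p.coeff (n * 2 + k)) hQ
  simp only [coeff_mul_add_eq_of_natDegree_le (hdeg n).le hQdeg, coeff_iterate_derivative,
    ← mul_pow, hcoeff, show n * 2 + k + k = (k + n) * 2 by ring, nsmul_eq_mul] at h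
  have hd := Nat.factorial_mul_descFactorial (show k ≤ (k + n) * 2 by omega)
  rw [show (k + n) * 2 - k = k + 2 * n by omega, show (k + n) * 2 = 2 * k + 2 * n by ring] at hd
  have hd' : ((k + 2 * n).factorial : ℝ) * ((2 * k + 2 * n).descFactorial k : ℝ) =
    (2 * k + 2 * n).factorial := by exact_mod_cast hd
  rw [show (k + n) * 2 = 2 * k + 2 * n by ring] at h
  have hs : ((-1 : ℝ) ^ n) * (-1) ^ n = 1 := by rw [← mul_pow]; simp
  rw [← hd', mul_div_cancel_left₀ _ (by positivity)]
  linear_combination (-(-1) ^ n) * h + ((-1) ^ k * ((2 * k + 2 * n).descFactorial k : ℝ)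
    - Q.coeff k) * hs

theorem Polynomial.eval_iterate_derivative_X_pow_mul_one_sub_X_pow_eq_sum (n k : ℕ) (t : ℝ) :
    (derivative^[k] (X ^ (k + n) * (1 - X) ^ (k + n) : ℝ[X])).eval t =
      ∑ j ∈ Finset.range (k + n + 1), (-1) ^ j * ((k + n).choose j : ℝ) *
        ((k + n + j).descFactorial k : ℝ) * t ^ (n + j) := by
  have h : (X ^ (k + n) * (1 - X) ^ (k + n) : ℝ[X]) = ∑ j ∈ Finset.range (k + n + 1),
      C ((-1) ^ j * ((k + n).choose j : ℝ)) * X ^ (k + n + j) := by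
    rw [show (1 - X : ℝ[X]) = -X + 1 by ring, add_pow, Finset.mul_sum]
    refine Finset.sum_congr rfl fun j _ => ?_
    rw [neg_pow]
    simp only [map_mul, map_pow, map_neg, map_one, map_natCast, one_pow]
    ring
  rw [h, iterate_derivative_sum, eval_finsetSum]
  refine Finset.sum_congr rfl fun j _ => ?_
  rw [iterate_derivative_C_mul, iterate_derivative_X_pow_eq_C_mul,
    show k + n + j - k = n + j by omega]
  simp [mul_assoc]

/-- Orthogonality of Jacobi polynomials with equal parameters, in terms of their Rodrigues form. -/
theorem Polynomial.integral_weight_mul_eq (n k k' : ℕ) (hk : k ≤ k') {Q Q' : ℝ[X]}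
    (hQdeg : Q.natDegree ≤ k)
    (hQcoeff : Q.coeff k = (-1) ^ k * ((2 * k + 2 * n).factorial / (k + 2 * n).factorial : ℝ))
    (hQ' : derivative^[k'] (X ^ (k' + n) * (1 - X) ^ (k' + n) : ℝ[X]) =
      X ^ n * (1 - X) ^ n * Q') :
    ∫ t in (0 : ℝ)..1, t ^ n * (1 - t) ^ n * Q.eval t * Q'.eval t =
      if k = k' then (k.factorial : ℝ) * ((k + n).factorial : ℝ) ^ 2 /
        ((k + 2 * n).factorial * (2 * k + 2 * n + 1)) else 0 := by
  have h1 : ∫ t in (0 : ℝ)..1, t ^ n * (1 - t) ^ n * Q.eval t * Q'.eval t =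
      ∫ t in (0 : ℝ)..1, Q.eval t *
        (derivative^[k'] (X ^ (k' + n) * (1 - X) ^ (k' + n) : ℝ[X])).eval t := by
    refine intervalIntegral.integral_congr fun t _ => ?_
    simp only [hQ', eval_mul, eval_pow, eval_X, eval_sub, eval_one]
    ring
  rw [h1, integral_eval_mul_eval_iterate_derivative _ (by omega)]
  split_ifs with hkk
  · subst hkk
    have h2 : derivative^[k] Q = C (k.factorial * Q.coeff k) := by
      have := natDegree_iterate_derivative Q k
      rw [eq_C_of_natDegree_eq_zero (p := derivative^[k] Q) (by omega), coeff_iterate_derivative]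
      simp [Nat.descFactorial_self]
    rw [h2]
    simp only [eval_C]
    rw [intervalIntegral.integral_const_mul, integral_eval_X_pow_mul_one_sub_X_pow, hQcoeff,
      show 2 * (k + n) + 1 = (2 * k + 2 * n) + 1 by ring, Nat.factorial_succ]
    have hs : ((-1 : ℝ) ^ k) * (-1) ^ k = 1 := by rw [← mul_pow]; simp
    have : ((2 * k + 2 * n).factorial : ℝ) ≠ 0 := by positivity
    push_cast
    field_simp
    linear_combination hs
  · rw [iterate_derivative_eq_zero (by omega)]
    simp

end PolynomialIntegration

theorem cpoch_succ (a : ℂ) (j : ℕ) : cpoch a (j + 1) = cpoch a j * (a + j) :=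
  Finset.prod_range_succ _ _

theorem factorial_mul_cpoch_natCast_add_one (a j : ℕ) :
    (a.factorial : ℂ) * cpoch (a + 1) j = ((a + j).factorial : ℂ) := by
  induction j with
  | zero => simp [cpoch]
  | succ j ih =>
    rw [cpoch_succ, ← mul_assoc, ih, ← add_assoc, Nat.factorial_succ]
    push_cast
    ring

theorem cpoch_neg_natCast (a j : ℕ) :
    cpoch (-(a : ℂ)) j = (-1) ^ j * (a.descFactorial j : ℂ) := by
  induction j with
  | zero => simp [cpoch]
  | succ j ih =>
    rw [cpoch_succ, ih, Nat.descFactorial_succ]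
    rcases le_or_gt j a with h | h
    · push_cast [h]
      ring
    · simp [Nat.descFactorial_of_lt h]

theorem hyp2F1_ferrers_eq_eval (n k : ℕ) (t : ℝ) :
    ((k + n).factorial : ℂ) * (t : ℂ) ^ n *
        hyp2F1 (-((k : ℂ) + n)) ((k : ℂ) + n + 1) ((n : ℂ) + 1) t =
      (n.factorial : ℂ) * (((Polynomial.derivative^[k]
        (Polynomial.X ^ (k + n) * (1 - Polynomial.X) ^ (k + n) : Polynomial ℝ)).eval t : ℝ) :
          ℂ) := by
  rw [Polynomial.eval_iterate_derivative_X_pow_mul_one_sub_X_pow_eq_sum, hyp2F1,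
    tsum_eq_sum (s := Finset.range (k + n + 1)), Finset.mul_sum, Complex.ofReal_sum,
    Finset.mul_sum]
  · refine Finset.sum_congr rfl fun j _ => ?_
    have h1 := factorial_mul_cpoch_natCast_add_one (k + n) j
    have h2 := factorial_mul_cpoch_natCast_add_one n j
    have h3 := cpoch_neg_natCast (k + n) j
    have h4 : ((n + j).factorial : ℂ) * ((k + n + j).descFactorial k : ℂ) =
        (k + n + j).factorial := by
      have := Nat.factorial_mul_descFactorial (show k ≤ k + n + j by omega)
      rw [show k + n + j - k = n + j by omega] at this
      exact_mod_cast this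
    rw [Nat.descFactorial_eq_factorial_mul_choose] at h3
    push_cast at h1 h2 h3 ⊢
    have hf (m : ℕ) : (m.factorial : ℂ) ≠ 0 := by exact_mod_cast m.factorial_ne_zero
    have hc : cpoch ((n : ℂ) + 1) j ≠ 0 := by
      intro h
      rw [h, mul_zero] at h2
      exact hf _ h2.symm
    have hj := hf j
    rw [h3, pow_add]
    field_simp
    linear_combination ((t : ℂ) ^ n * ((k + n).choose j : ℂ) * (t : ℂ) ^ j) *
      (h1 - h4 - ((k + n + j).descFactorial k : ℂ) * h2)
  · intro j hj
    have h := cpoch_neg_natCast (k + n) j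
    rw [Nat.descFactorial_of_lt (by simpa using hj)] at h
    push_cast at h
    rw [h]
    simp

theorem ferrersP_eq_eval (n k : ℕ) {Q : Polynomial ℝ}
    (hQ : Polynomial.derivative^[k]
      (Polynomial.X ^ (k + n) * (1 - Polynomial.X) ^ (k + n) : Polynomial ℝ) =
        Polynomial.X ^ n * (1 - Polynomial.X) ^ n * Q) {x : ℝ} (hx : x ∈ Set.Ioo (-1 : ℝ) 1) :
    ferrersP ((k : ℂ) + n) n x = (((1 - x) / (1 + x) : ℝ) : ℂ) ^ ((n : ℂ) / 2) *
      (((1 + x) / 2 : ℝ) : ℂ) ^ n * ((Q.eval ((1 - x) / 2) : ℝ) : ℂ) / ((k + n).factorial : ℂ) := by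
  have h := hyp2F1_ferrers_eq_eval n k ((1 - x) / 2)
  have ht : ((((1 - x) / 2 : ℝ) : ℂ)) ^ n ≠ 0 :=
    pow_ne_zero _ (Complex.ofReal_ne_zero.2 (by linarith [hx.2]))
  have hf (m : ℕ) : (m.factorial : ℂ) ≠ 0 := by exact_mod_cast m.factorial_ne_zero
  have hn := hf n
  have hkn := hf (k + n)
  rw [hQ] at h
  simp only [Polynomial.eval_mul, Polynomial.eval_pow, Polynomial.eval_X, Polynomial.eval_sub,
    Polynomial.eval_one, show 1 - (1 - x) / 2 = (1 + x) / 2 by ring] at h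
  rw [Complex.ofReal_mul, Complex.ofReal_mul, Complex.ofReal_pow, Complex.ofReal_pow] at h
  have h' : ((k + n).factorial : ℂ) *
      hyp2F1 (-((k : ℂ) + n)) ((k : ℂ) + n + 1) ((n : ℂ) + 1) (((1 - x) / 2 : ℝ) : ℂ) =
      n.factorial * ((((1 + x) / 2 : ℝ) : ℂ) ^ n * ((Q.eval ((1 - x) / 2) : ℝ) : ℂ)) :=
    mul_left_cancel₀ ht (by linear_combination h)
  rw [ferrersP, Complex.Gamma_nat_eq_factorial, eq_div_iff hkn, mul_assoc, mul_comm (hyp2F1 _ _ _ _),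
    h']
  field_simp

theorem ferrersP_mul_ferrersP_eq_eval (n k k' : ℕ) {Q Q' : Polynomial ℝ}
    (hQ : Polynomial.derivative^[k]
      (Polynomial.X ^ (k + n) * (1 - Polynomial.X) ^ (k + n) : Polynomial ℝ) =
        Polynomial.X ^ n * (1 - Polynomial.X) ^ n * Q)
    (hQ' : Polynomial.derivative^[k']
      (Polynomial.X ^ (k' + n) * (1 - Polynomial.X) ^ (k' + n) : Polynomial ℝ) =
        Polynomial.X ^ n * (1 - Polynomial.X) ^ n * Q') {x : ℝ} (hx : x ∈ Set.Ioo (-1 : ℝ) 1) :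
    ferrersP ((k : ℂ) + n) n x * ferrersP ((k' : ℂ) + n) n x =
      (((1 - x) / 2) ^ n * (1 - (1 - x) / 2) ^ n * Q.eval ((1 - x) / 2) *
        Q'.eval ((1 - x) / 2) : ℝ) / (((k + n).factorial : ℂ) * (k' + n).factorial) := by
  have h1 : 1 + x ≠ 0 := by linarith [hx.1]
  have h2 : 1 - x ≠ 0 := by linarith [hx.2]
  have hpow : (((1 - x) / (1 + x) : ℝ) : ℂ) ^ ((n : ℂ) / 2) *
      (((1 - x) / (1 + x) : ℝ) : ℂ) ^ ((n : ℂ) / 2) = (((1 - x) / (1 + x) : ℝ) : ℂ) ^ n := by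
    rw [← Complex.cpow_add _ _ (Complex.ofReal_ne_zero.2 (div_ne_zero h2 h1)), add_halves,
      Complex.cpow_natCast]
  have hbase : ((1 - x) / 2) ^ n * (1 - (1 - x) / 2) ^ n =
      ((1 - x) / (1 + x)) ^ n * (((1 + x) / 2) ^ n * ((1 + x) / 2) ^ n) := by
    rw [← mul_pow, ← mul_pow, ← mul_pow]
    congr 1
    field_simp
    ring
  rw [ferrersP_eq_eval n k hQ hx, ferrersP_eq_eval n k' hQ' hx, hbase, div_mul_div_comm]
  congr 1
  simp only [Complex.ofReal_mul, Complex.ofReal_pow]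
  rw [← hpow]
  ring

theorem integral_ferrersP_mul_ferrersP_of_le (n k k' : ℕ) (hk : k ≤ k') :
    ∫ x in (-1 : ℝ)..1, ferrersP ((k : ℂ) + n) n x * ferrersP ((k' : ℂ) + n) n x =
      if k = k' then 2 * (k.factorial : ℂ) / ((k + 2 * n).factorial * (2 * k + 2 * n + 1))
      else 0 := by
  obtain ⟨Q, hQ, hdeg, hcoeff⟩ := Polynomial.exists_iterate_derivative_eq_mul n k
  obtain ⟨Q', hQ', -, -⟩ := Polynomial.exists_iterate_derivative_eq_mul n k'
  set f : ℝ → ℝ := fun t => t ^ n * (1 - t) ^ n * Q.eval t * Q'.eval t with hf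
  have h1 : ∫ x in (-1 : ℝ)..1, ferrersP ((k : ℂ) + n) n x * ferrersP ((k' : ℂ) + n) n x =
      ∫ x in (-1 : ℝ)..1, ((f (1 / 2 - x / 2) : ℝ) : ℂ) /
        (((k + n).factorial : ℂ) * (k' + n).factorial) := by
    rw [intervalIntegral.integral_of_le (by norm_num), intervalIntegral.integral_of_le (by norm_num),
      MeasureTheory.integral_Ioc_eq_integral_Ioo, MeasureTheory.integral_Ioc_eq_integral_Ioo]
    refine MeasureTheory.setIntegral_congr_fun measurableSet_Ioo fun x hx => ?_
    simp only [ferrersP_mul_ferrersP_eq_eval n k k' hQ hQ' hx, hf, sub_div]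
  rw [h1, intervalIntegral.integral_div, intervalIntegral.integral_ofReal,
    intervalIntegral.integral_comp_sub_div f two_ne_zero]
  norm_num only
  rw [hf, Polynomial.integral_weight_mul_eq n k k' hk hdeg hcoeff hQ']
  split_ifs with hkk
  · subst hkk
    have : ((k + n).factorial : ℂ) ≠ 0 := by exact_mod_cast (k + n).factorial_ne_zero
    push_cast [smul_eq_mul]
    field_simp
  · simp

theorem integral_ferrersP_mul_ferrersP (n k k' : ℕ) :
    ∫ x in (-1 : ℝ)..1, ferrersP ((k : ℂ) + n) n x * ferrersP ((k' : ℂ) + n) n x =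
      if k = k' then 2 * (k.factorial : ℂ) / ((k + 2 * n).factorial * (2 * k + 2 * n + 1))
      else 0 := by
  rcases le_or_gt k k' with hk | hk
  · exact integral_ferrersP_mul_ferrersP_of_le n k k' hk
  · simp_rw [mul_comm (ferrersP ((k : ℂ) + n) n _)]
    rw [integral_ferrersP_mul_ferrersP_of_le n k' k hk.le, if_neg hk.ne, if_neg hk.ne']

theorem ferrersP_mixed_orthogonality (n k k' : ℕ) :
    ∫ x in (-1 : ℝ)..1, ferrersPosP ((k : ℂ) + n) n x * ferrersP ((k' : ℂ) + n) (n : ℂ) x =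
      if k = k' then (-1) ^ n / ((n : ℂ) + k + 1 / 2) else 0 := by
  have hG1 : Complex.Gamma ((k : ℂ) + n + n + 1) = ((k + 2 * n).factorial : ℂ) := by
    rw [← Complex.Gamma_nat_eq_factorial]; push_cast; ring_nf
  have hG2 : Complex.Gamma ((k : ℂ) + n - n + 1) = (k.factorial : ℂ) := by
    rw [add_sub_cancel_right, Complex.Gamma_nat_eq_factorial]
  simp only [ferrersPosP, mul_assoc]
  rw [intervalIntegral.integral_const_mul, intervalIntegral.integral_const_mul,
    integral_ferrersP_mul_ferrersP, hG1, hG2]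
  split_ifs with hkk
  · have hf (m : ℕ) : (m.factorial : ℂ) ≠ 0 := by exact_mod_cast m.factorial_ne_zero
    have h1 := hf k
    have h2 := hf (k + 2 * n)
    have h3 : (2 * (k : ℂ) + 2 * n + 1) ≠ 0 := by
      exact_mod_cast (2 * k + 2 * n).succ_ne_zero
    have h4 : (n : ℂ) + k + 1 / 2 = (2 * k + 2 * n + 1) / 2 := by ring
    rw [h4]
    field_simp
  · simp
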